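/- Let a, b be complex numbers, let k be a nonnegative integer, and let x be a complex number with Im(a·x + b) > 0. Then the k-th iterated derivative of t ↦ cot(a·t + b) at x equals -i·δ_{0k} - 2i·(2i a)^k·Li_{-k}(e^{2i(a x + b)}), where δ_{0k} = 1 if k = 0 and 0 otherwise; explicitly, it equals -i·δ_{0k} - 2i·(2i a)^k·Σ_{n=1}^{∞} n^k e^{2i(a x + b)n}. -/

import Mathlib

open Finset Complex

/-- Derivative of the polylogarithm series of negative integer order. -/
theorem hasDerivAt_polylog_aux (k : ℕ) (q : ℂ) (hq : ‖q‖ < 1) :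
    HasDerivAt (fun w : ℂ => ∑' n : ℕ, ((n : ℂ) + 1) ^ k * w ^ (n + 1))
      (∑' n : ℕ, ((n : ℂ) + 1) ^ (k + 1) * q ^ n) q := by
  obtain ⟨r, hr1, hr2⟩ := exists_between hq
  have hr0 : 0 < r := lt_of_le_of_lt (norm_nonneg q) hr1
  have hs : Summable (fun n : ℕ => ((n : ℝ) + 1) ^ (k + 1) * r ^ n) := by
    have h1 : Summable (fun n : ℕ => (n : ℝ) ^ (k + 1) * r ^ n) :=
      summable_pow_mul_geometric_of_norm_lt_one (k + 1)
        (by rwa [Real.norm_of_nonneg hr0.le])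
    have h2 := ((summable_nat_add_iff 1).2 h1).mul_right r⁻¹
    refine h2.congr fun n => ?_
    push_cast
    field_simp
    ring
  refine hasDerivAt_tsum_of_isPreconnected (t := Metric.ball (0 : ℂ) r) (y₀ := 0)
    (g := fun (n : ℕ) (w : ℂ) => ((n : ℂ) + 1) ^ k * w ^ (n + 1))
    (g' := fun (n : ℕ) (w : ℂ) => ((n : ℂ) + 1) ^ (k + 1) * w ^ n) hs
    Metric.isOpen_ball (convex_ball _ _).isPreconnected ?_ ?_ ?_ ?_ ?_
  · intro n y _
    have h := (hasDerivAt_pow (n + 1) y).const_mul (((n : ℂ) + 1) ^ k)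
    refine h.congr_deriv ?_
    rw [Nat.add_sub_cancel]
    push_cast
    ring
  · intro n y hy
    have hy' : ‖y‖ ≤ r := by simpa using (Metric.mem_ball.1 hy).le
    have h1 : ‖(n : ℂ) + 1‖ = (n : ℝ) + 1 := by
      have := Complex.norm_natCast (n + 1)
      push_cast at this
      exact this
    rw [norm_mul, norm_pow, norm_pow, h1]
    gcongr
  · simpa using hr0
  · simp
  · simpa using hr1

theorem norm_exp_aux (z : ℂ) (h : 0 < z.im) : ‖Complex.exp (2 * I * z)‖ < 1 := by
  rw [Complex.norm_exp, Real.exp_lt_one_iff]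
  simp
  exact h

theorem cot_aux (z : ℂ) (h : 0 < z.im) :
    Complex.cot z = -I - 2 * I * ∑' n : ℕ, Complex.exp (2 * I * z) ^ (n + 1) := by
  have hq := norm_exp_aux z h
  rw [Complex.cot_eq_exp_ratio]
  set q := Complex.exp (2 * I * z) with hqd
  have h1 : (1 : ℂ) - q ≠ 0 := by
    intro h0
    have : q = 1 := (sub_eq_zero.1 h0).symm
    rw [this] at hq
    simp at hq
  have h2 : ∑' n : ℕ, q ^ (n + 1) = q * (1 - q)⁻¹ := by
    rw [← tsum_geometric_of_norm_lt_one hq, ← tsum_mul_left]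
    exact tsum_congr fun n => pow_succ' q n
  rw [h2]
  have hI : I ≠ 0 := I_ne_zero
  field_simp
  linear_combination (2 * q + 1 - q) * I_sq

/-- For `a b : ℂ`, `k : ℕ` and `x : ℂ` with `Im(a·x+b) > 0`,
`d^k/dx^k cot(ax+b) = -i·δ_{0k} - 2i·(2ia)^k·Li_{-k}(e^{2i(ax+b)})`,
where `Li_{-k}(z) = ∑_{n=1}^∞ n^k z^n`. -/
theorem iteratedDeriv_cot_translated (a b : ℂ) (k : ℕ) (x : ℂ) (h : 0 < (a * x + b).im) :
    iteratedDeriv k (fun t => Complex.cot (a * t + b)) x =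
      -I * (if k = 0 then 1 else 0) - 2 * I * (2 * I * a) ^ k *
        ∑' n : ℕ, ((n : ℂ) + 1) ^ k * Complex.exp (2 * I * (a * x + b)) ^ (n + 1) := by
  induction k generalizing x with
  | zero => simpa using cot_aux _ h
  | succ k ih =>
    rw [iteratedDeriv_succ]
    have hopen : IsOpen {t : ℂ | 0 < (a * t + b).im} :=
      isOpen_lt continuous_const (by fun_prop)
    have hev := Filter.eventuallyEq_of_mem (hopen.mem_nhds h) (fun t ht => ih t ht)
    rw [hev.deriv_eq]
    have hE : HasDerivAt (fun t : ℂ => Complex.exp (2 * I * (a * t + b)))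
        (Complex.exp (2 * I * (a * x + b)) * (2 * I * (a * 1))) x :=
      ((((hasDerivAt_id x).const_mul a).add_const b).const_mul (2 * I)).cexp
    have hS := (hasDerivAt_polylog_aux k _ (norm_exp_aux _ h)).comp x hE
    have hT := (hS.const_mul (2 * I * (2 * I * a) ^ k)).const_sub
      (-I * (if k = 0 then 1 else 0))
    refine hT.deriv.trans ?_
    have hsum : ∑' n : ℕ, ((n : ℂ) + 1) ^ (k + 1) * Complex.exp (2 * I * (a * x + b)) ^ (n + 1)
        = (∑' n : ℕ, ((n : ℂ) + 1) ^ (k + 1) * Complex.exp (2 * I * (a * x + b)) ^ n)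
          * Complex.exp (2 * I * (a * x + b)) := by
      rw [← tsum_mul_right]
      exact tsum_congr fun n => by ring
    rw [hsum]
    simp only [Nat.add_eq_zero_iff, one_ne_zero, and_false, if_false]
    ring
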